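/- arXiv:2404.14144 — 4 statements merged into one kernel-verified Lean document; each statement's English description precedes it below -/
import Mathlib

section
/- Let p ≥ 2 and set ω_c := sqrt(p^p/(p−1)^{p−1}). For every complex number z with |z| > ω_c, the series R_∞(z) := Σ_{k ≥ 0} F_p(k)·z^{−(2k+1)} converges absolutely, and R_∞(z) satisfies the algebraic identity z^{p−2}·R_∞(z)^p − z·R_∞(z) + 1 = 0. -/
open scoped BigOperators

noncomputable section

/-- Fuss–Catalan numbers `F_p(k) = (1/(pk+1)) * choose (pk+1) k`. -/
def fussCatalan (p k : ℕ) : ℝ := ((p * k + 1).choose k : ℝ) / (p * k + 1)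

/-- The Raney numbers `a / (a + p n) * choose (a + p n) n`, written so as to avoid a vanishing
denominator. -/
def raney (p : ℕ) : ℕ → ℕ → ℝ
  | 0, _ => 1
  | n + 1, a => a * (a + p * n + (p - 1)).choose n / (n + 1)

theorem raney_succ_zero (p n : ℕ) : raney p (n + 1) 0 = 0 := by simp [raney]

theorem raney_succ_add_one {p : ℕ} (hp : 1 ≤ p) (n a : ℕ) :
    raney p (n + 1) (a + 1) = raney p (n + 1) a + raney p n (a + p) := by
  obtain ⟨q, rfl⟩ : ∃ q, p = q + 1 := ⟨p - 1, by omega⟩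
  cases n with
  | zero => simp [raney]
  | succ m =>
    simp only [raney, Nat.add_sub_cancel]
    set N := a + (q + 1) * (m + 1) + q with hN
    have e1 : a + 1 + (q + 1) * (m + 1) + q = N + 1 := by rw [hN]; ring
    have e2 : a + (q + 1) + (q + 1) * m + q = N := by rw [hN]; ring
    have hmN : m ≤ N := by rw [hN]; nlinarith [Nat.zero_le (q * m)]
    have hc := congrArg (Nat.cast (R := ℝ)) (Nat.choose_succ_right_eq N m)
    push_cast [Nat.cast_sub hmN] at hc
    have hNr : (N : ℝ) = a + (q + 1) * (m + 1) + q := by rw [hN]; push_cast; ring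
    rw [e1, e2, Nat.choose_succ_succ']
    push_cast
    field_simp
    rw [hNr] at hc
    linear_combination hc

/-- The Rothe–Hagen convolution identity. -/
theorem sum_antidiagonal_raney_mul {p : ℕ} (hp : 1 ≤ p) (n a b : ℕ) :
    ∑ kl ∈ Finset.HasAntidiagonal.antidiagonal n, raney p kl.1 a * raney p kl.2 b = raney p n (a + b) := by
  induction n generalizing a b with
  | zero => simp [raney]
  | succ n ihn =>
    induction a with
    | zero =>
      rw [Finset.Nat.sum_antidiagonal_succ]
      simp [raney]
    | succ a iha =>
      rw [Finset.Nat.sum_antidiagonal_succ] at iha ⊢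
      simp only [raney_succ_add_one hp, add_mul, Finset.sum_add_distrib, ihn]
      rw [add_right_comm a 1 b, raney_succ_add_one hp, ← iha, add_right_comm a p b]
      simp only [raney]
      ring

theorem raney_one {p : ℕ} (hp : 1 ≤ p) (n : ℕ) : raney p n 1 = fussCatalan p n := by
  obtain ⟨q, rfl⟩ : ∃ q, p = q + 1 := ⟨p - 1, by omega⟩
  cases n with
  | zero => simp [raney, fussCatalan]
  | succ n =>
    simp only [raney, fussCatalan, Nat.add_sub_cancel]
    have e : 1 + (q + 1) * n + q = (q + 1) * (n + 1) := by ring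
    have hc := congrArg (Nat.cast (R := ℝ)) (Nat.add_one_mul_choose_eq ((q + 1) * (n + 1)) n)
    push_cast at hc
    rw [e]
    push_cast
    field_simp
    linear_combination hc

theorem raney_self {p : ℕ} (hp : 1 ≤ p) (n : ℕ) : raney p n p = fussCatalan p (n + 1) := by
  have h := raney_succ_add_one hp n 0
  rw [raney_succ_zero, zero_add, zero_add, zero_add, raney_one hp] at h
  exact h.symm

/-- The generating function of the Raney numbers with parameter `a` is the `a`-th power of that of
the Fuss–Catalan numbers. -/
theorem summable_norm_raney_and_tsum_eq_pow {p : ℕ} (hp : 1 ≤ p) {x : ℂ}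
    (hx : Summable fun n : ℕ => ‖(fussCatalan p n : ℂ) * x ^ n‖) (a : ℕ) :
    Summable (fun n : ℕ => ‖(raney p n a : ℂ) * x ^ n‖) ∧
      ∑' n : ℕ, (raney p n a : ℂ) * x ^ n = (∑' n : ℕ, (fussCatalan p n : ℂ) * x ^ n) ^ a := by
  induction a with
  | zero =>
    have h : ∀ n : ℕ, n ≠ 0 → (raney p n 0 : ℂ) * x ^ n = 0 := by
      rintro (_ | n) hn
      · exact absurd rfl hn
      · simp [raney_succ_zero]
    refine ⟨summable_of_ne_finset_zero (s := {0}) fun n hn => ?_, ?_⟩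
    · rw [h n (by simpa using hn), norm_zero]
    · rw [tsum_eq_single 0 h]
      simp [raney]
  | succ a ih =>
    have key : (fun n : ℕ => (raney p n (a + 1) : ℂ) * x ^ n) = fun n =>
        ∑ kl ∈ Finset.HasAntidiagonal.antidiagonal n,
          ((raney p kl.1 a : ℂ) * x ^ kl.1) * ((fussCatalan p kl.2 : ℂ) * x ^ kl.2) := by
      funext n
      rw [← sum_antidiagonal_raney_mul hp]
      push_cast
      rw [Finset.sum_mul]
      refine Finset.sum_congr rfl fun kl hkl => ?_
      rw [raney_one hp, ← Finset.HasAntidiagonal.mem_antidiagonal.mp hkl, pow_add]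
      ring
    constructor
    · exact (summable_norm_sum_mul_antidiagonal_of_summable_norm ih.1 hx).congr fun n =>
        congrArg norm (congrFun key n).symm
    · rw [key, ← tsum_mul_tsum_eq_tsum_sum_antidiagonal_of_summable_norm ih.1 hx, ih.2, pow_succ]

/-- The functional equation `f = 1 + x f ^ p` of the Fuss–Catalan generating function. -/
theorem tsum_fussCatalan_eq {p : ℕ} (hp : 1 ≤ p) {x : ℂ}
    (hx : Summable fun n : ℕ => ‖(fussCatalan p n : ℂ) * x ^ n‖) :
    ∑' n : ℕ, (fussCatalan p n : ℂ) * x ^ n =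
      1 + x * (∑' n : ℕ, (fussCatalan p n : ℂ) * x ^ n) ^ p := by
  rw [← (summable_norm_raney_and_tsum_eq_pow hp hx p).2, hx.of_norm.tsum_eq_zero_add,
    ← tsum_mul_left]
  congr 1
  · simp [fussCatalan]
  · refine tsum_congr fun n => ?_
    rw [raney_self hp, pow_succ]
    ring

theorem fussCatalan_nonneg (p k : ℕ) : 0 ≤ fussCatalan p k := by
  unfold fussCatalan
  positivity

theorem fussCatalan_le {p : ℕ} (hp : 2 ≤ p) (k : ℕ) :
    fussCatalan p k ≤ p * ((p : ℝ) ^ p / ((p : ℝ) - 1) ^ (p - 1)) ^ k := by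
  obtain ⟨q, rfl⟩ : ∃ q, p = q + 1 := ⟨p - 1, by omega⟩
  have hq : (1 : ℝ) ≤ q := by exact_mod_cast (by omega : 1 ≤ q)
  have hbinom : (((q + 1) * k + 1).choose k : ℝ) * (q : ℝ) ^ (q * k + 1)
      ≤ ((q : ℝ) + 1) ^ ((q + 1) * k + 1) := by
    have hk : k ∈ Finset.range ((q + 1) * k + 1 + 1) := by
      rw [Finset.mem_range]; nlinarith [Nat.zero_le (q * k)]
    have hsub : (q + 1) * k + 1 - k = q * k + 1 := by
      rw [add_mul, one_mul]; omega
    have h := Finset.single_le_sum (f := fun m => (1 : ℝ) ^ m * (q : ℝ) ^ ((q + 1) * k + 1 - m) *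
      (((q + 1) * k + 1).choose m : ℝ)) (fun m _ => by positivity) hk
    rw [← add_pow, hsub, one_pow, one_mul, add_comm (1 : ℝ)] at h
    linarith
  calc fussCatalan (q + 1) k ≤ (((q + 1) * k + 1).choose k : ℝ) := by
        unfold fussCatalan
        refine div_le_self (by positivity) ?_
        push_cast
        nlinarith [Nat.cast_nonneg (α := ℝ) k]
    _ ≤ ((q : ℝ) + 1) ^ ((q + 1) * k + 1) / (q : ℝ) ^ (q * k) := by
        rw [le_div_iff₀ (by positivity)]
        refine le_trans ?_ hbinom
        gcongr
        exact Nat.le_succ _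
    _ = _ := by
        push_cast
        rw [add_sub_cancel_right, div_pow, ← pow_mul, ← pow_mul, pow_succ]
        ring

theorem summable_norm_fussCatalan_mul_pow {p : ℕ} (hp : 2 ≤ p) {x : ℂ}
    (hx : (p : ℝ) ^ p / ((p : ℝ) - 1) ^ (p - 1) * ‖x‖ < 1) :
    Summable fun n : ℕ => ‖(fussCatalan p n : ℂ) * x ^ n‖ := by
  have hp1 : (0 : ℝ) < (p : ℝ) - 1 := by
    have : (2 : ℝ) ≤ p := by exact_mod_cast hp
    linarith
  refine Summable.of_nonneg_of_le (fun _ => norm_nonneg _) (fun n => ?_)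
    ((summable_geometric_of_lt_one (by positivity) hx).mul_left (p : ℝ))
  rw [norm_mul, norm_pow, Complex.norm_real, Real.norm_of_nonneg (fussCatalan_nonneg p n),
    mul_pow, ← mul_assoc]
  gcongr
  exact fussCatalan_le hp n

/-- **The Cauchy–Stieltjes transform of the limiting measure.** For `p ≥ 2` and `z ∈ ℂ` with
`|z| > ω_c = sqrt(p^p/(p-1)^(p-1))`, the series `R_∞(z) = Σ_k F_p(k) z^{-(2k+1)}` converges
absolutely and satisfies `z^(p-2) R_∞(z)^p - z R_∞(z) + 1 = 0`. -/
theorem resolvent_algebraic_identity (p : ℕ) (hp : 2 ≤ p) (z : ℂ)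
    (hz : Real.sqrt ((p : ℝ) ^ p / ((p : ℝ) - 1) ^ (p - 1)) < ‖z‖) :
    Summable (fun k : ℕ => ‖(fussCatalan p k : ℂ) * z ^ (-(2 * (k : ℤ) + 1))‖) ∧
    z ^ (p - 2) * (∑' k : ℕ, (fussCatalan p k : ℂ) * z ^ (-(2 * (k : ℤ) + 1))) ^ p -
        z * (∑' k : ℕ, (fussCatalan p k : ℂ) * z ^ (-(2 * (k : ℤ) + 1))) + 1 = 0 := by
  have hz0 : 0 < ‖z‖ := (Real.sqrt_nonneg _).trans_lt hz
  have hzne : z ≠ 0 := norm_pos_iff.mp hz0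
  have hx : (p : ℝ) ^ p / ((p : ℝ) - 1) ^ (p - 1) * ‖(z ^ 2)⁻¹‖ < 1 := by
    rw [norm_inv, norm_pow, ← div_eq_mul_inv, div_lt_one (by positivity)]
    exact (Real.sqrt_lt' hz0).mp hz
  have hsum := summable_norm_fussCatalan_mul_pow hp hx
  have hterm : (fun k : ℕ => (fussCatalan p k : ℂ) * z ^ (-(2 * (k : ℤ) + 1))) =
      fun k => z⁻¹ * ((fussCatalan p k : ℂ) * (z ^ 2)⁻¹ ^ k) := by
    funext k
    have e : z ^ (-(2 * (k : ℤ) + 1)) = z⁻¹ * (z ^ 2)⁻¹ ^ k := by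
      rw [zpow_neg, zpow_add₀ hzne, zpow_one, zpow_mul, zpow_natCast, mul_inv, inv_pow, mul_comm]
      rfl
    rw [e]
    ring
  constructor
  · have h := hsum.mul_left ‖z⁻¹‖
    simp only [← norm_mul] at h
    exact h.congr fun k => congrArg norm (congrFun hterm k).symm
  · rw [hterm, tsum_mul_left]
    have hf := tsum_fussCatalan_eq (by omega : 1 ≤ p) hsum
    set f := ∑' k : ℕ, (fussCatalan p k : ℂ) * (z ^ 2)⁻¹ ^ k
    have hpow : z ^ (p - 2) * (z⁻¹ * f) ^ p = (z ^ 2)⁻¹ * f ^ p := by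
      obtain ⟨m, rfl⟩ := Nat.exists_eq_add_of_le' hp
      rw [Nat.add_sub_cancel, mul_pow, inv_pow, pow_add z]
      field_simp
    rw [hpow, mul_inv_cancel_left₀ hzne]
    linear_combination -hf
end
end

section
/- Let p ≥ 1, N ≥ 1, let T be a symmetric p-tensor of dimension N, and let z = it with t ∈ ℝ, t ≠ 0. Then N·Ξ_T(z) = ∫_{ℝ^N} ( ‖φ‖² − z^{−1}·(T·φ^p) )·exp( −( (1/2)‖φ‖² − z^{−1}·(T·φ^p)/p ) )·(2π)^{−N/2} dφ, where both sides are absolutely convergent complex integrals. -/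
open scoped BigOperators
open MeasureTheory

noncomputable section

/-- `T·φ^p = Σ_{i_1,…,i_p} T_{i_1…i_p} φ_{i_1} ⋯ φ_{i_p}`. -/
def tensorPhi (p N : ℕ) (T : (Fin p → Fin N) → ℝ) (φ : Fin N → ℝ) : ℝ :=
  ∑ i : Fin p → Fin N, T i * ∏ j, φ (i j)

/-- The exponent `-(‖φ‖²/2 - z⁻¹ (T·φ^p)/p)` appearing in Gurau's partition function. -/
def resExponent (p N : ℕ) (T : (Fin p → Fin N) → ℝ) (z : ℂ) (φ : Fin N → ℝ) : ℂ :=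
  -((1 / 2) * ∑ x, (φ x : ℂ) ^ 2 - z⁻¹ * (tensorPhi p N T φ : ℂ) / p)

/-- The normalizing constant `(2π)^{-N/2}` of the measure `[dφ]`. -/
def gaussConst (N : ℕ) : ℂ := (((2 * Real.pi) ^ (-(N : ℝ) / 2) : ℝ) : ℂ)

/-- Gurau's partition function `Ξ_T(z) = ∫ exp(-(‖φ‖²/2 - z⁻¹ (T·φ^p)/p)) [dφ]`. -/
def XiT (p N : ℕ) (T : (Fin p → Fin N) → ℝ) (z : ℂ) : ℂ :=
  ∫ φ : Fin N → ℝ, Complex.exp (resExponent p N T z φ) * gaussConst N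

/-- The unnormalized resolvent trace
`A_T(z) = z⁻¹ ∫ (‖φ‖²/N) exp(-(‖φ‖²/2 - z⁻¹ (T·φ^p)/p)) [dφ]`,
so that the resolvent trace is `R_T(z) = A_T(z)/Ξ_T(z)`. -/
def AT (p N : ℕ) (T : (Fin p → Fin N) → ℝ) (z : ℂ) : ℂ :=
  z⁻¹ * ∫ φ : Fin N → ℝ,
    ((∑ x, (φ x : ℂ) ^ 2) / N) * Complex.exp (resExponent p N T z φ) * gaussConst N

open MvPolynomial in
theorem MvPolynomial.hasLineDerivAt_eval {ι : Type*} [DecidableEq ι] (P : MvPolynomial ι ℝ)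
    (φ : ι → ℝ) (x : ι) :
    HasLineDerivAt ℝ (fun ψ : ι → ℝ => eval ψ P) (eval φ (pderiv x P)) φ (Pi.single x 1) := by
  induction P using MvPolynomial.induction_on with
  | C a => simpa [HasLineDerivAt] using hasDerivAt_const (0 : ℝ) a
  | add P Q hP hQ =>
    simp only [HasLineDerivAt, map_add] at *
    exact hP.fun_add hQ
  | mul_X P y hP =>
    have hX : HasDerivAt (fun s : ℝ => (φ + s • Pi.single x (1 : ℝ) : ι → ℝ) y)
        ((Pi.single x (1 : ℝ) : ι → ℝ) y) 0 := by
      simpa using ((hasDerivAt_id (0 : ℝ)).mul_const ((Pi.single x (1 : ℝ) : ι → ℝ) y)).const_add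
        (φ y)
    simp only [HasLineDerivAt, map_mul, eval_X] at *
    refine (hP.fun_mul hX).congr_deriv ?_
    by_cases h : x = y
    · subst h
      simp
      ring
    · simp [pderiv_X, Ne.symm h, mul_comm]

theorem integrable_pow_mul_exp_neg_half_sq (n : ℕ) :
    Integrable fun s : ℝ => s ^ n * Real.exp (-(s ^ 2 / 2)) := by
  have h := integrable_rpow_mul_exp_neg_mul_sq (b := 1 / 2) (by norm_num)
    (s := n) (by linarith [n.cast_nonneg (α := ℝ)])
  refine h.congr (.of_forall fun s => ?_)
  simp only [Real.rpow_natCast]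
  ring_nf

theorem MvPolynomial.integrable_eval_mul_exp_neg_half_sq {ι : Type*} [Fintype ι]
    (P : MvPolynomial ι ℝ) :
    Integrable fun φ : ι → ℝ => eval φ P * Real.exp (-((∑ x, φ x ^ 2) / 2)) := by
  induction P using MvPolynomial.induction_on' with
  | add P Q hP hQ => exact (hP.add hQ).congr (.of_forall fun φ => by simp [add_mul])
  | monomial u a =>
    have h := (Integrable.fintype_prod (ι := ι) (μ := fun _ => volume)
      fun x => integrable_pow_mul_exp_neg_half_sq (u x)).const_mul a
    refine h.congr (.of_forall fun φ => ?_)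
    simp only [eval_monomial, Finset.prod_mul_distrib, ← Real.exp_sum, Finset.sum_neg_distrib,
      Finset.sum_div, mul_assoc]
    rw [Finsupp.prod_fintype _ _ (by simp)]

theorem MvPolynomial.integrable_eval_mul_cexp {ι : Type*} [Fintype ι] (P R : MvPolynomial ι ℝ)
    {c : ℂ} (hc : c.re = 0) :
    Integrable fun φ : ι → ℝ =>
      (eval φ P : ℂ) * Complex.exp (c * (eval φ R : ℝ) - (eval φ (∑ x, X x ^ 2) : ℝ) / 2) := by
  have hcont (Q : MvPolynomial ι ℝ) : Continuous fun φ : ι → ℝ => ((eval φ Q : ℝ) : ℂ) :=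
    Complex.continuous_ofReal.comp Q.continuous_eval
  refine P.integrable_eval_mul_exp_neg_half_sq.mono ?_ (.of_forall fun φ => ?_)
  · exact ((hcont P).mul (Complex.continuous_exp.comp
      ((continuous_const.mul (hcont R)).sub ((hcont _).div_const 2)))).aestronglyMeasurable
  · rw [norm_mul, norm_mul, Complex.norm_exp, Complex.norm_real,
      Real.norm_of_nonneg (Real.exp_nonneg _)]
    have hre : (c * (eval φ R : ℝ) - (eval φ (∑ x, X x ^ 2) : ℝ) / 2 : ℂ).re
        = -((∑ x, φ x ^ 2) / 2) := by
      rw [Complex.sub_re, Complex.re_mul_ofReal, hc, Complex.div_ofNat_re, Complex.ofReal_re]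
      simp
    rw [hre]

/-- Integration by parts in the `x`-th coordinate against an oscillating Gaussian weight. -/
theorem MvPolynomial.integral_mul_pderiv_cexp {ι : Type*} [Fintype ι]
    (R : MvPolynomial ι ℝ) {c : ℂ} (hc : c.re = 0) (x : ι) :
    let Q : MvPolynomial ι ℝ := ∑ y, X y ^ 2
    Integrable (fun φ : ι → ℝ =>
      ((eval φ (X x * pderiv x Q) : ℝ) / 2 - c * (eval φ (X x * pderiv x R) : ℝ)) *
        Complex.exp (c * (eval φ R : ℝ) - (eval φ Q : ℝ) / 2)) ∧
    ∫ φ : ι → ℝ, ((eval φ (X x * pderiv x Q) : ℝ) / 2 - c * (eval φ (X x * pderiv x R) : ℝ)) *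
        Complex.exp (c * (eval φ R : ℝ) - (eval φ Q : ℝ) / 2) =
      ∫ φ : ι → ℝ, Complex.exp (c * (eval φ R : ℝ) - (eval φ Q : ℝ) / 2) := by
  classical
  intro Q
  have hint (P : MvPolynomial ι ℝ) := P.integrable_eval_mul_cexp R hc
  have hI : Integrable fun φ : ι → ℝ =>
      ((eval φ (X x * pderiv x Q) : ℝ) / 2 - c * (eval φ (X x * pderiv x R) : ℝ)) *
        Complex.exp (c * (eval φ R : ℝ) - (eval φ Q : ℝ) / 2) := by
    refine (((hint (X x * pderiv x Q)).div_const 2).sub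
      ((hint (X x * pderiv x R)).const_mul c)).congr (.of_forall fun φ => ?_)
    simp only [Pi.sub_apply]
    ring
  refine ⟨hI, ?_⟩
  have hderiv (P : MvPolynomial ι ℝ) (φ : ι → ℝ) :
      HasLineDerivAt ℝ (fun ψ : ι → ℝ => ((eval ψ P : ℝ) : ℂ)) (eval φ (pderiv x P) : ℝ) φ
        (Pi.single x 1) :=
    HasDerivAt.ofReal_comp (P.hasLineDerivAt_eval φ x)
  have hparts := integral_bilinear_hasLineDerivAt_right_eq_neg_left_of_integrable
    (μ := (volume : Measure (ι → ℝ))) (B := ContinuousLinearMap.mul ℝ ℂ) (v := Pi.single x 1)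
    (f := fun φ => ((eval φ (X x) : ℝ) : ℂ)) (f' := fun φ => ((eval φ (pderiv x (X x)) : ℝ) : ℂ))
    (g := fun φ => Complex.exp (c * (eval φ R : ℝ) - (eval φ Q : ℝ) / 2))
    (g' := fun φ => Complex.exp (c * (eval φ R : ℝ) - (eval φ Q : ℝ) / 2) *
      (c * (eval φ (pderiv x R) : ℝ) - (eval φ (pderiv x Q) : ℝ) / 2))
    (hint _) ?_ (hint _) (fun φ _ => hderiv _ φ) (fun φ _ => ?_)
  · simp only [ContinuousLinearMap.mul_apply', pderiv_X_self, map_one, Complex.ofReal_one,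
      one_mul] at hparts
    rw [← neg_eq_iff_eq_neg.mpr hparts, ← integral_neg]
    refine integral_congr_ae (.of_forall fun φ => ?_)
    simp only [map_mul, Complex.ofReal_mul]
    ring
  · refine hI.neg.congr (.of_forall fun φ => ?_)
    simp only [Pi.neg_apply, map_mul, Complex.ofReal_mul, ContinuousLinearMap.mul_apply']
    ring
  · have h := ((HasDerivAt.const_mul c (hderiv R φ)).fun_sub
      (HasDerivAt.div_const (hderiv Q φ) 2)).cexp
    simpa [HasLineDerivAt] using h

theorem MvPolynomial.card_mul_integral_cexp_of_isHomogeneous {ι : Type*} [Fintype ι]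
    {R : MvPolynomial ι ℝ} {p : ℕ} (hR : R.IsHomogeneous p) {c : ℂ} (hc : c.re = 0) :
    Integrable (fun φ : ι → ℝ => ((∑ x, (φ x : ℂ) ^ 2) - c * p * (eval φ R : ℝ)) *
      Complex.exp (c * (eval φ R : ℝ) - (∑ x, (φ x : ℂ) ^ 2) / 2)) ∧
    Fintype.card ι *
        ∫ φ : ι → ℝ, Complex.exp (c * (eval φ R : ℝ) - (∑ x, (φ x : ℂ) ^ 2) / 2) =
      ∫ φ : ι → ℝ, ((∑ x, (φ x : ℂ) ^ 2) - c * p * (eval φ R : ℝ)) *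
        Complex.exp (c * (eval φ R : ℝ) - (∑ x, (φ x : ℂ) ^ 2) / 2) := by
  have hQ (φ : ι → ℝ) : ∑ x, (φ x : ℂ) ^ 2 = (eval φ (∑ x, X x ^ 2) : ℝ) := by simp
  have hQhom : (∑ x, X x ^ 2 : MvPolynomial ι ℝ).IsHomogeneous 2 :=
    IsHomogeneous.sum _ _ _ fun x _ => isHomogeneous_X_pow x 2
  have hparts (x : ι) := R.integral_mul_pderiv_cexp hc x
  have hEuler {P : MvPolynomial ι ℝ} {n : ℕ} (hP : P.IsHomogeneous n) (φ : ι → ℝ) :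
      ∑ x, ((eval φ (X x * pderiv x P) : ℝ) : ℂ) = n * (eval φ P : ℝ) := by
    rw [← Complex.ofReal_sum, ← map_sum, hP.sum_X_mul_pderiv]
    simp
  simp only [hQ]
  have hsum (φ : ι → ℝ) :
      (((eval φ (∑ x, X x ^ 2) : ℝ) : ℂ) - c * p * (eval φ R : ℝ)) *
        Complex.exp (c * (eval φ R : ℝ) - (eval φ (∑ x, X x ^ 2) : ℝ) / 2) =
      ∑ x, (((eval φ (X x * pderiv x (∑ y, X y ^ 2)) : ℝ) : ℂ) / 2
          - c * (eval φ (X x * pderiv x R) : ℝ)) *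
        Complex.exp (c * (eval φ R : ℝ) - (eval φ (∑ y, X y ^ 2) : ℝ) / 2) := by
    rw [← Finset.sum_mul, Finset.sum_sub_distrib, ← Finset.sum_div, ← Finset.mul_sum,
      hEuler hQhom, hEuler hR]
    push_cast
    ring
  simp only [hsum]
  refine ⟨integrable_finsetSum _ fun x _ => (hparts x).1, ?_⟩
  rw [integral_finsetSum _ fun x _ => (hparts x).1, Finset.sum_congr rfl fun x _ => (hparts x).2]
  simp

open MvPolynomial in
theorem exists_isHomogeneous_eval_eq_tensorPhi (p N : ℕ) (T : (Fin p → Fin N) → ℝ) :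
    ∃ R : MvPolynomial (Fin N) ℝ, R.IsHomogeneous p ∧ ∀ φ, eval φ R = tensorPhi p N T φ := by
  refine ⟨∑ i : Fin p → Fin N, C (T i) * ∏ j, X (i j), IsHomogeneous.sum _ _ _ fun i _ => ?_,
    fun φ => by simp [tensorPhi]⟩
  have h := IsHomogeneous.prod Finset.univ (fun j => (X (i j) : MvPolynomial (Fin N) ℝ))
    (fun _ => 1) fun j _ => isHomogeneous_X ℝ (i j)
  simpa using h.C_mul (T i)

/-- **Integration by parts for the partition function.** For a symmetric `p`-tensor `T` and
`z = it`, `t ≠ 0`, all integrals converge absolutely and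
`N Ξ_T(z) = ∫ (‖φ‖² - z⁻¹ (T·φ^p)) exp(-(‖φ‖²/2 - z⁻¹ (T·φ^p)/p)) [dφ]`. -/
theorem partition_function_identity (p N : ℕ) (hp : 1 ≤ p)
    (T : (Fin p → Fin N) → ℝ)
    (hT : ∀ (i : Fin p → Fin N) (ρ : Equiv.Perm (Fin p)), T (i ∘ ρ) = T i)
    (t : ℝ) (ht : t ≠ 0) :
    Integrable
      (fun φ : Fin N → ℝ =>
        Complex.exp (resExponent p N T (Complex.I * t) φ) * gaussConst N) volume ∧
    Integrable
      (fun φ : Fin N → ℝ =>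
        ((∑ x, (φ x : ℂ) ^ 2) - (Complex.I * t)⁻¹ * (tensorPhi p N T φ : ℂ)) *
          Complex.exp (resExponent p N T (Complex.I * t) φ) * gaussConst N) volume ∧
    (N : ℂ) * XiT p N T (Complex.I * t) =
      ∫ φ : Fin N → ℝ,
        ((∑ x, (φ x : ℂ) ^ 2) - (Complex.I * t)⁻¹ * (tensorPhi p N T φ : ℂ)) *
          Complex.exp (resExponent p N T (Complex.I * t) φ) * gaussConst N := by
  obtain ⟨R, hR, hRT⟩ := exists_isHomogeneous_eval_eq_tensorPhi p N T
  have hp0 : (p : ℂ) ≠ 0 := by exact_mod_cast (by omega : p ≠ 0)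
  set z : ℂ := Complex.I * t
  have hc : (z⁻¹ / p).re = 0 := by
    simp [z, Complex.inv_re]
  have hexp (φ : Fin N → ℝ) : resExponent p N T z φ =
      z⁻¹ / p * (tensorPhi p N T φ : ℝ) - (∑ x, (φ x : ℂ) ^ 2) / 2 := by
    rw [resExponent]
    ring
  obtain ⟨hint, heq⟩ := MvPolynomial.card_mul_integral_cexp_of_isHomogeneous hR hc
  have hw := MvPolynomial.integrable_eval_mul_cexp 1 R hc
  simp only [hRT, ← hexp, div_mul_cancel₀ _ hp0, Fintype.card_fin] at hint heq
  refine ⟨?_, hint.mul_const _, ?_⟩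
  · refine (hw.mul_const (gaussConst N)).congr (.of_forall fun φ => ?_)
    simp [hexp, hRT]
  · rw [XiT, integral_mul_const, integral_mul_const, ← mul_assoc, heq]
end
end

section
/- Let p ≥ 1, N ≥ 1, let T be a symmetric p-tensor of dimension N, and for z = it with t ∈ ℝ\{0} define A_T(z) := z^{−1}·∫_{ℝ^N} (‖φ‖²/N)·exp( −( (1/2)‖φ‖² − z^{−1}·(T·φ^p)/p ) )·(2π)^{−N/2} dφ. Then the function t ↦ Ξ_T(it) is differentiable on ℝ\{0}, and writing Ξ'_T(it) := −i·(d/dt)[Ξ_T(it)] (the derivative of Ξ_T with respect to z along the imaginary axis), one has for every z = it with t ≠ 0: A_T(z) = z^{−1}·Ξ_T(z) − (p/N)·Ξ'_T(z). In particular, wherever Ξ_T(z) ≠ 0, the resolvent trace R_T(z) := A_T(z)/Ξ_T(z) satisfies R_T(z) = z^{−1} − (p/N)·(d/dz) ln Ξ_T(z). -/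
open scoped BigOperators
open MeasureTheory

noncomputable section

/-- The weight `exp(-a‖φ‖² + i b T·φ^p)`. -/
def gaussWeight (p N : ℕ) (T : (Fin p → Fin N) → ℝ) (a b : ℝ) (φ : Fin N → ℝ) : ℂ :=
  Complex.exp (-(a : ℂ) * (∑ x, φ x ^ 2 : ℝ) + b * Complex.I * tensorPhi p N T φ)

section
variable {p N : ℕ} (T : (Fin p → Fin N) → ℝ)

theorem norm_gaussWeight (a b : ℝ) (φ : Fin N → ℝ) :
    ‖gaussWeight p N T a b φ‖ = Real.exp (-a * ∑ x, φ x ^ 2) := by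
  rw [gaussWeight, Complex.norm_exp]
  congr 1
  simp only [Complex.add_re, Complex.mul_re, Complex.mul_im, Complex.ofReal_re,
    Complex.ofReal_im, Complex.I_re, Complex.I_im, Complex.neg_re, Complex.neg_im]
  ring

theorem continuous_tensorPhi : Continuous (tensorPhi p N T) := by
  unfold tensorPhi; fun_prop

theorem continuous_gaussWeight (a b : ℝ) : Continuous (gaussWeight p N T a b) := by
  have := continuous_tensorPhi T
  unfold gaussWeight; fun_prop

theorem integrable_exp_neg_mul_sum_sq {c : ℝ} (hc : 0 < c) :
    Integrable (fun φ : Fin N → ℝ => Real.exp (-c * ∑ x, φ x ^ 2)) := by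
  simp_rw [Finset.mul_sum, Real.exp_sum]
  exact Integrable.fintype_prod (f := fun _ x => Real.exp (-c * x ^ 2))
    fun _ => integrable_exp_neg_mul_sq hc

theorem abs_le_inv_mul_exp_sq {c : ℝ} (hc : 0 < c) (x : ℝ) :
    |x| ≤ c⁻¹ * Real.exp (c ^ 2 * x ^ 2) := by
  rw [← div_eq_inv_mul, le_div_iff₀ hc]
  have h1 := Real.add_one_le_exp (c ^ 2 * x ^ 2)
  nlinarith [sq_nonneg (c * |x| - 1), sq_abs x, sq_nonneg (c * x)]

theorem abs_tensorPhi_le {c : ℝ} (hc : 0 < c) (φ : Fin N → ℝ) :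
    |tensorPhi p N T φ| ≤
      (∑ i, |T i|) * (c⁻¹ ^ p * Real.exp (p * c ^ 2 * ∑ x, φ x ^ 2)) := by
  rw [tensorPhi, Finset.sum_mul]
  refine (Finset.abs_sum_le_sum_abs _ _).trans (Finset.sum_le_sum fun i _ => ?_)
  rw [abs_mul, Finset.abs_prod]
  gcongr
  calc ∏ j, |φ (i j)| ≤ ∏ _j : Fin p, c⁻¹ * Real.exp (c ^ 2 * ∑ x, φ x ^ 2) := by
        refine Finset.prod_le_prod (fun _ _ => abs_nonneg _) fun j _ => ?_
        refine (abs_le_inv_mul_exp_sq hc _).trans ?_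
        gcongr
        exact Finset.single_le_sum (f := fun x => φ x ^ 2) (fun x _ => sq_nonneg _)
          (Finset.mem_univ (i j))
    _ = _ := by
        rw [Finset.prod_const, Finset.card_univ, Fintype.card_fin, mul_pow, ← Real.exp_nat_mul,
          mul_assoc (p : ℝ)]

/-- Polynomial growth is absorbed by the Gaussian. -/
theorem integrable_add_abs_mul_exp :
    Integrable (fun φ : Fin N → ℝ =>
      (∑ x, φ x ^ 2 + |tensorPhi p N T φ|) * Real.exp (-(1 / 4) * ∑ x, φ x ^ 2)) := by
  have hV := continuous_tensorPhi T
  obtain ⟨c, hc, hpc⟩ : ∃ c : ℝ, 0 < c ∧ p * c ^ 2 ≤ 1 / 8 := by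
    refine ⟨(4 * (p + 1 : ℝ))⁻¹, by positivity, ?_⟩
    rw [inv_pow, ← div_eq_mul_inv, div_le_iff₀ (by positivity)]
    nlinarith [(Nat.cast_nonneg p : (0 : ℝ) ≤ p)]
  refine ((integrable_exp_neg_mul_sum_sq (N := N) (c := 1 / 8) (by norm_num)).const_mul
    (8 + (∑ i, |T i|) * c⁻¹ ^ p)).mono' (by fun_prop) (ae_of_all _ fun φ => ?_)
  have hQ : 0 ≤ ∑ x, φ x ^ 2 := Finset.sum_nonneg fun x _ => sq_nonneg _
  have hT0 : 0 ≤ ∑ i, |T i| := Finset.sum_nonneg fun i _ => abs_nonneg _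
  rw [Real.norm_of_nonneg (by positivity)]
  have hφ := abs_tensorPhi_le T hc φ
  set Q := ∑ x, φ x ^ 2
  have h1 : Q ≤ 8 * Real.exp (1 / 8 * Q) := by
    linarith [Real.add_one_le_exp (1 / 8 * Q)]
  have h2 : |tensorPhi p N T φ| ≤ (∑ i, |T i|) * c⁻¹ ^ p * Real.exp (1 / 8 * Q) := by
    rw [mul_assoc]
    refine hφ.trans ?_
    gcongr
  calc _ ≤ (8 * Real.exp (1 / 8 * Q) + (∑ i, |T i|) * c⁻¹ ^ p * Real.exp (1 / 8 * Q)) *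
        Real.exp (-(1 / 4) * Q) := by gcongr
    _ = (8 + (∑ i, |T i|) * c⁻¹ ^ p) * Real.exp (1 / 8 * Q + -(1 / 4) * Q) := by
        rw [Real.exp_add]; ring
    _ = _ := by congr 2; ring

theorem norm_linear_mul_gaussWeight_le {a b C u v : ℝ} (ha : 1 / 4 ≤ a) (hu : |u| ≤ C)
    (hv : |v| ≤ C) (φ : Fin N → ℝ) :
    ‖(u * (∑ x, φ x ^ 2 : ℝ) + v * Complex.I * tensorPhi p N T φ) * gaussWeight p N T a b φ‖ ≤
      C * ((∑ x, φ x ^ 2 + |tensorPhi p N T φ|) * Real.exp (-(1 / 4) * ∑ x, φ x ^ 2)) := by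
  have hQ : 0 ≤ ∑ x, φ x ^ 2 := Finset.sum_nonneg fun x _ => sq_nonneg _
  rw [norm_mul, norm_gaussWeight, ← mul_assoc]
  have hC : 0 ≤ C := (abs_nonneg u).trans hu
  gcongr
  refine (norm_add_le _ _).trans ?_
  simp only [norm_mul, Complex.norm_real, Complex.norm_I, Real.norm_eq_abs, mul_one]
  rw [abs_of_nonneg hQ, mul_add]
  gcongr

theorem integrable_linear_mul_gaussWeight {a : ℝ} (ha : 1 / 4 ≤ a) (b u v : ℝ) :
    Integrable (fun φ : Fin N → ℝ =>
      (u * (∑ x, φ x ^ 2 : ℝ) + v * Complex.I * tensorPhi p N T φ) *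
        gaussWeight p N T a b φ) := by
  have h1 := continuous_tensorPhi T
  have h2 := continuous_gaussWeight T a b
  exact ((integrable_add_abs_mul_exp T).const_mul (max |u| |v|)).mono' (by fun_prop)
    (ae_of_all _ fun φ => norm_linear_mul_gaussWeight_le T ha (le_max_left _ _)
      (le_max_right _ _) φ)

theorem integrable_gaussWeight {a : ℝ} (ha : 0 < a) (b : ℝ) :
    Integrable (gaussWeight p N T a b) :=
  (integrable_exp_neg_mul_sum_sq ha).mono' (continuous_gaussWeight T a b).aestronglyMeasurable
    (ae_of_all _ fun φ => (norm_gaussWeight T a b φ).le)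

theorem hasDerivAt_integral_gaussWeight {α α' β β' : ℝ → ℝ} {t : ℝ}
    (hα : ∀ᶠ s in nhds t, HasDerivAt α (α' s) s) (hβ : ∀ᶠ s in nhds t, HasDerivAt β (β' s) s)
    (hα' : ContinuousAt α' t) (hβ' : ContinuousAt β' t) (ht : 1 / 4 < α t) :
    HasDerivAt (fun s => ∫ φ, gaussWeight p N T (α s) (β s) φ)
      (∫ φ, (((-α' t : ℝ) : ℂ) * (∑ x, φ x ^ 2 : ℝ) +
        β' t * Complex.I * tensorPhi p N T φ) * gaussWeight p N T (α t) (β t) φ) t := by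
  have hU : {s | HasDerivAt α (α' s) s ∧ HasDerivAt β (β' s) s ∧ 1 / 4 < α s ∧
      |α' s| < max |α' t| |β' t| + 1 ∧ |β' s| < max |α' t| |β' t| + 1} ∈ nhds t := by
    filter_upwards [hα, hβ, hα.self_of_nhds.continuousAt.eventually_const_lt ht,
      hα'.abs.eventually_lt_const (lt_add_of_le_of_pos (le_max_left |α' t| |β' t|) one_pos),
      hβ'.abs.eventually_lt_const (lt_add_of_le_of_pos (le_max_right |α' t| |β' t|) one_pos)]
      with s h1 h2 h3 h4 h5 using ⟨h1, h2, h3, h4, h5⟩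
  refine (hasDerivAt_integral_of_dominated_loc_of_deriv_le
    (F := fun s φ => gaussWeight p N T (α s) (β s) φ)
    (F' := fun s φ => (((-α' s : ℝ) : ℂ) * (∑ x, φ x ^ 2 : ℝ) +
        β' s * Complex.I * tensorPhi p N T φ) * gaussWeight p N T (α s) (β s) φ)
    hU (Filter.Eventually.of_forall fun s => (continuous_gaussWeight T _ _).aestronglyMeasurable)
    (integrable_gaussWeight T (by linarith) _)
    (integrable_linear_mul_gaussWeight T ht.le _ _ _).aestronglyMeasurable
    (ae_of_all _ fun φ s hs => norm_linear_mul_gaussWeight_le T hs.2.2.1.le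
      (by rw [abs_neg]; exact hs.2.2.2.1.le) hs.2.2.2.2.le φ)
    ((integrable_add_abs_mul_exp T).const_mul _) (ae_of_all _ fun φ s hs => ?_)).2
  unfold gaussWeight
  refine HasDerivAt.congr_deriv ((hs.1.ofReal_comp.neg.mul_const ((∑ x, φ x ^ 2 : ℝ) : ℂ)).add
    ((hs.2.1.ofReal_comp.mul_const Complex.I).mul_const (tensorPhi p N T φ : ℂ))).cexp ?_
  simp only [Pi.add_apply, Pi.neg_apply]
  push_cast
  ring

theorem tensorPhi_smul (s : ℝ) (φ : Fin N → ℝ) :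
    tensorPhi p N T (s • φ) = s ^ p * tensorPhi p N T φ := by
  simp only [tensorPhi, Pi.smul_apply, smul_eq_mul, Finset.prod_mul_distrib, Finset.prod_const,
    Finset.card_univ, Fintype.card_fin, Finset.mul_sum]
  exact Finset.sum_congr rfl fun i _ => by ring

theorem gaussWeight_smul (a b s : ℝ) (φ : Fin N → ℝ) :
    gaussWeight p N T a b (s • φ) = gaussWeight p N T (a * s ^ 2) (b * s ^ p) φ := by
  simp only [gaussWeight, tensorPhi_smul, Pi.smul_apply, smul_eq_mul, mul_pow, ← Finset.mul_sum]
  push_cast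
  ring_nf

/-- The Schwinger–Dyson equation for the dilation field `φ·∂_φ`. -/
theorem integral_dilation_gaussWeight (b : ℝ) :
    ∫ φ, (((-1 : ℝ) : ℂ) * (∑ x, φ x ^ 2 : ℝ) +
        ((p * b : ℝ) : ℂ) * Complex.I * tensorPhi p N T φ) * gaussWeight p N T (1 / 2) b φ =
      -N * ∫ φ, gaussWeight p N T (1 / 2) b φ := by
  have hL := hasDerivAt_integral_gaussWeight T (t := 1) (α := fun s => 1 / 2 * s ^ 2)
    (α' := fun s => 1 / 2 * (2 * s)) (β := fun s => b * s ^ p)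
    (β' := fun s => b * (p * s ^ (p - 1)))
    (Filter.Eventually.of_forall fun s =>
      ((hasDerivAt_pow 2 s).const_mul (1 / 2)).congr_deriv (by simp))
    (Filter.Eventually.of_forall fun s => (hasDerivAt_pow p s).const_mul b)
    (by fun_prop) (by fun_prop) (by norm_num)
  have hR : HasDerivAt (fun s : ℝ => (((s ^ N)⁻¹ : ℝ) : ℂ) * ∫ φ, gaussWeight p N T (1 / 2) b φ)
      (-N * ∫ φ, gaussWeight p N T (1 / 2) b φ) 1 := by
    have h := ((hasDerivAt_pow N (1 : ℝ)).inv (by simp)).ofReal_comp.mul_const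
      (∫ φ, gaussWeight p N T (1 / 2) b φ)
    simpa using h
  have hE : (fun s : ℝ => ∫ φ, gaussWeight p N T (1 / 2 * s ^ 2) (b * s ^ p) φ) =ᶠ[nhds 1]
      fun s : ℝ => (((s ^ N)⁻¹ : ℝ) : ℂ) * ∫ φ, gaussWeight p N T (1 / 2) b φ := by
    filter_upwards [lt_mem_nhds one_pos] with s hs
    simp_rw [← gaussWeight_smul]
    rw [Measure.integral_comp_smul, Module.finrank_fin_fun, abs_of_pos (by positivity),
      Complex.real_smul]
  have := hL.unique (hR.congr_of_eventuallyEq hE)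
  simpa [mul_comm b] using this

theorem exp_resExponent (s : ℝ) (φ : Fin N → ℝ) :
    Complex.exp (resExponent p N T (Complex.I * s) φ) =
      gaussWeight p N T (1 / 2) (-s⁻¹ / p) φ := by
  rw [resExponent, gaussWeight, mul_inv, Complex.inv_I]
  push_cast
  ring_nf

theorem XiT_eq (s : ℝ) :
    XiT p N T (Complex.I * s) =
      (∫ φ, gaussWeight p N T (1 / 2) (-s⁻¹ / p) φ) * gaussConst N := by
  simp_rw [XiT, exp_resExponent, integral_mul_const]

theorem AT_eq (s : ℝ) :
    AT p N T (Complex.I * s) = (Complex.I * s)⁻¹ *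
      ((∫ φ, ((∑ x, φ x ^ 2 : ℝ) : ℂ) * gaussWeight p N T (1 / 2) (-s⁻¹ / p) φ) *
        gaussConst N / N) := by
  simp_rw [AT, exp_resExponent, integral_mul_const, div_mul_eq_mul_div, integral_div]
  push_cast
  ring

theorem hasDerivAt_XiT {t : ℝ} (ht : t ≠ 0) :
    HasDerivAt (fun s : ℝ => XiT p N T (Complex.I * s))
      ((t ^ 2 : ℂ)⁻¹ / p * Complex.I * (∫ φ, (tensorPhi p N T φ : ℂ) *
        gaussWeight p N T (1 / 2) (-t⁻¹ / p) φ) * gaussConst N) t := by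
  simp_rw [XiT_eq]
  have h := (hasDerivAt_integral_gaussWeight T (t := t) (α := fun _ => 1 / 2)
    (α' := fun _ => 0) (β := fun s => -s⁻¹ / p) (β' := fun s => (s ^ 2)⁻¹ / p)
    (Filter.Eventually.of_forall fun s => hasDerivAt_const _ _)
    (by
      filter_upwards [isOpen_ne.mem_nhds ht] with s hs
      simpa using (hasDerivAt_inv hs).neg.div_const (p : ℝ))
    (by fun_prop) (((continuousAt_id.pow 2).inv₀ (pow_ne_zero 2 ht)).div_const _)
    (by norm_num)).mul_const (gaussConst N)
  refine h.congr_deriv ?_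
  rw [← integral_const_mul]
  congr 2 with φ
  push_cast
  ring

theorem AT_eq_XiT_sub (hp : 1 ≤ p) (hN : 1 ≤ N) {t : ℝ} (ht : t ≠ 0) :
    AT p N T (Complex.I * t) = (Complex.I * t)⁻¹ * XiT p N T (Complex.I * t) -
      ((p : ℂ) / N) * (-Complex.I * ((t ^ 2 : ℂ)⁻¹ / p * Complex.I *
        (∫ φ, (tensorPhi p N T φ : ℂ) * gaussWeight p N T (1 / 2) (-t⁻¹ / p) φ) *
          gaussConst N)) := by
  have hp0 : (p : ℂ) ≠ 0 := by exact_mod_cast (by lia : p ≠ 0)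
  have hN0 : (N : ℂ) ≠ 0 := by exact_mod_cast (by lia : N ≠ 0)
  have ht0 : (t : ℂ) ≠ 0 := by exact_mod_cast ht
  have hSD := integral_dilation_gaussWeight (p := p) (N := N) T (-t⁻¹ / p)
  have hQ : Integrable fun φ : Fin N → ℝ =>
      ((∑ x, φ x ^ 2 : ℝ) : ℂ) * gaussWeight p N T (1 / 2) (-t⁻¹ / p) φ := by
    simpa using integrable_linear_mul_gaussWeight T (a := 1 / 2) (by norm_num) (-t⁻¹ / p) 1 0
  have hV : Integrable fun φ : Fin N → ℝ => Complex.I *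
      (tensorPhi p N T φ * gaussWeight p N T (1 / 2) (-t⁻¹ / p) φ) := by
    simpa [mul_assoc] using
      integrable_linear_mul_gaussWeight T (a := 1 / 2) (by norm_num) (-t⁻¹ / p) 0 1
  have hsplit : ∀ φ : Fin N → ℝ, (((-1 : ℝ) : ℂ) * (∑ x, φ x ^ 2 : ℝ) +
        ((p * (-t⁻¹ / p) : ℝ) : ℂ) * Complex.I * tensorPhi p N T φ) *
          gaussWeight p N T (1 / 2) (-t⁻¹ / p) φ =
      (-1 : ℂ) * (((∑ x, φ x ^ 2 : ℝ) : ℂ) * gaussWeight p N T (1 / 2) (-t⁻¹ / p) φ) +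
        (-(t : ℂ)⁻¹) * (Complex.I *
          (tensorPhi p N T φ * gaussWeight p N T (1 / 2) (-t⁻¹ / p) φ)) := fun φ => by
    push_cast
    field_simp
  simp_rw [hsplit] at hSD
  rw [integral_add (hQ.const_mul _) (hV.const_mul _)] at hSD
  simp_rw [integral_const_mul] at hSD
  rw [AT_eq, XiT_eq]
  generalize (∫ φ, gaussWeight p N T (1 / 2) (-t⁻¹ / p) φ) = X at *
  generalize (∫ φ, (tensorPhi p N T φ : ℂ) * gaussWeight p N T (1 / 2) (-t⁻¹ / p) φ) = V at *
  generalize (∫ φ, ((∑ x, φ x ^ 2 : ℝ) : ℂ) * gaussWeight p N T (1 / 2) (-t⁻¹ / p) φ) = Q at *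
  have hQeq : Q = N * X - (t : ℂ)⁻¹ * (Complex.I * V) := by linear_combination -hSD
  rw [hQeq, mul_inv, Complex.inv_I]
  field_simp
  ring_nf

end

/-- **The resolvent trace as a logarithmic derivative (Proposition).** For a symmetric
`p`-tensor `T` (`N ≥ 1`), the function `t ↦ Ξ_T(it)` is differentiable away from `0` and,
writing `Ξ'_T(it) = -i (d/dt) Ξ_T(it)` for the derivative along the imaginary axis,
`A_T(z) = z⁻¹ Ξ_T(z) - (p/N) Ξ'_T(z)` at `z = it`; in particular wherever `Ξ_T(z) ≠ 0`, the
resolvent trace `R_T = A_T/Ξ_T` satisfies `R_T(z) = z⁻¹ - (p/N) (d/dz) ln Ξ_T(z)`. -/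
theorem resolvent_log_derivative (p N : ℕ) (hp : 1 ≤ p) (hN : 1 ≤ N)
    (T : (Fin p → Fin N) → ℝ)
    (hT : ∀ (i : Fin p → Fin N) (ρ : Equiv.Perm (Fin p)), T (i ∘ ρ) = T i) :
    ∀ t : ℝ, t ≠ 0 → ∃ d : ℂ,
      HasDerivAt (fun s : ℝ => XiT p N T (Complex.I * s)) d t ∧
      AT p N T (Complex.I * t) =
        (Complex.I * t)⁻¹ * XiT p N T (Complex.I * t) -
          ((p : ℂ) / N) * (-Complex.I * d) ∧
      (XiT p N T (Complex.I * t) ≠ 0 →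
        AT p N T (Complex.I * t) / XiT p N T (Complex.I * t) =
          (Complex.I * t)⁻¹ -
            ((p : ℂ) / N) * ((-Complex.I * d) / XiT p N T (Complex.I * t))) := by
  intro t ht
  refine ⟨_, hasDerivAt_XiT T ht, AT_eq_XiT_sub T hp hN ht, fun hX => ?_⟩
  rw [AT_eq_XiT_sub T hp hN ht]
  field_simp
end
end

section
/- Let M be a real symmetric N×N matrix and let z ∈ ℝ with z > ‖M‖ (the operator norm of M). Then the integrals Ξ_M(z) := ∫_{ℝ^N} exp( −(1/2)⟨φ, (I − z^{−1}M)φ⟩ )·(2π)^{−N/2} dφ and A_M(z) := z^{−1}·∫_{ℝ^N} (‖φ‖²/N)·exp( −(1/2)⟨φ, (I − z^{−1}M)φ⟩ )·(2π)^{−N/2} dφ converge, Ξ_M(z) > 0, and A_M(z)/Ξ_M(z) = (1/N)·Tr( (zI − M)^{−1} ). In other words, the Gaussian-integral resolvent trace of a symmetric matrix coincides with the usual normalized resolvent trace. -/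
open scoped BigOperators
open MeasureTheory

noncomputable section

/-- The Gaussian partition function of a symmetric matrix `M`:
`Ξ_M(z) = ∫ exp(-(1/2)⟨φ, (I - z⁻¹ M) φ⟩) (2π)^{-N/2} dφ`. -/
def XiM (N : ℕ) (M : Matrix (Fin N) (Fin N) ℝ) (z : ℝ) : ℝ :=
  ∫ φ : Fin N → ℝ,
    Real.exp (-(1 / 2) * ∑ x, φ x * (φ x - z⁻¹ * M.mulVec φ x)) *
      ((2 * Real.pi) ^ (-(N : ℝ) / 2))

/-- The unnormalized Gaussian-integral resolvent trace of a symmetric matrix `M`: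
`A_M(z) = z⁻¹ ∫ (‖φ‖²/N) exp(-(1/2)⟨φ, (I - z⁻¹ M) φ⟩) (2π)^{-N/2} dφ`. -/
def AM (N : ℕ) (M : Matrix (Fin N) (Fin N) ℝ) (z : ℝ) : ℝ :=
  z⁻¹ * ∫ φ : Fin N → ℝ,
    ((∑ x, φ x ^ 2) / N) *
      Real.exp (-(1 / 2) * ∑ x, φ x * (φ x - z⁻¹ * M.mulVec φ x)) *
      ((2 * Real.pi) ^ (-(N : ℝ) / 2))

open Matrix in
/-- A real symmetric matrix is orthogonally diagonalizable, with eigenvalues bounded by its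
operator norm. -/
theorem Matrix.IsSymm.exists_orthogonal_diagonalization {n : Type*} [Fintype n] [DecidableEq n]
    {M : Matrix n n ℝ} (hM : M.IsSymm) :
    ∃ (U : Matrix n n ℝ) (d : n → ℝ), Uᵀ * U = 1 ∧ M = U * diagonal d * Uᵀ ∧
      ∀ i, |d i| ≤ ‖toEuclideanCLM (𝕜 := ℝ) M‖ := by
  have hA : M.IsHermitian := by rwa [IsHermitian, conjTranspose_eq_transpose_of_trivial]
  refine ⟨hA.eigenvectorUnitary, hA.eigenvalues, ?_, ?_, fun i => ?_⟩
  · rw [← conjTranspose_eq_transpose_of_trivial]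
    exact Unitary.coe_star_mul_self hA.eigenvectorUnitary
  · conv_lhs => rw [hA.spectral_theorem, Unitary.conjStarAlgAut_apply]
    rw [← conjTranspose_eq_transpose_of_trivial]
    rfl
  · have h := (toEuclideanCLM (𝕜 := ℝ) M).le_opNorm (hA.eigenvectorBasis i)
    have he : toEuclideanCLM (𝕜 := ℝ) M (hA.eigenvectorBasis i) =
        hA.eigenvalues i • hA.eigenvectorBasis i :=
      WithLp.ofLp_injective 2 (hA.mulVec_eigenvectorBasis i)
    rwa [he, norm_smul, hA.eigenvectorBasis.orthonormal.1 i, mul_one, mul_one,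
      Real.norm_eq_abs] at h

open Matrix in
theorem measurePreserving_mulVec_of_transpose_mul_self {n : Type*} [Fintype n] [DecidableEq n]
    {U : Matrix n n ℝ} (hU : Uᵀ * U = 1) :
    MeasurePreserving (fun x : n → ℝ => U *ᵥ x) := by
  have hdet : U.det * U.det = 1 := by
    simpa [det_mul, det_transpose] using congrArg det hU
  have habs : |U.det| = 1 := by
    rcases mul_self_eq_one_iff.mp hdet with h | h <;> simp [h]
  refine ⟨by fun_prop, ?_⟩
  have h := Real.map_matrix_volume_pi_eq_smul_volume_pi (M := U) (left_ne_zero_of_mul_eq_one hdet)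
  rwa [abs_inv, habs, inv_one, ENNReal.ofReal_one, one_smul] at h

open Matrix in
theorem measurableEmbedding_mulVec_of_transpose_mul_self {n : Type*} [Fintype n] [DecidableEq n]
    {U : Matrix n n ℝ} (hU : Uᵀ * U = 1) :
    MeasurableEmbedding (fun x : n → ℝ => U *ᵥ x) := by
  refine Continuous.measurableEmbedding (by fun_prop) fun x y hxy => ?_
  simpa [mulVec_mulVec, hU] using congrArg (Uᵀ *ᵥ ·) hxy

theorem integrable_sq_mul_exp_neg_mul_sq {b : ℝ} (hb : 0 < b) :
    Integrable fun x : ℝ => x ^ 2 * Real.exp (-b * x ^ 2) := by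
  simpa using integrable_rpow_mul_exp_neg_mul_sq hb (by norm_num : (-1 : ℝ) < 2)

theorem integral_sq_mul_exp_neg_mul_sq {b : ℝ} (hb : 0 < b) :
    ∫ x : ℝ, x ^ 2 * Real.exp (-b * x ^ 2) = (2 * b)⁻¹ * ∫ x : ℝ, Real.exp (-b * x ^ 2) := by
  have hderiv (x : ℝ) : HasDerivAt (fun x : ℝ => -(2 * b)⁻¹ * Real.exp (-b * x ^ 2))
      (x * Real.exp (-b * x ^ 2)) x := by
    convert! ((((hasDerivAt_id x).pow 2).const_mul (-b)).exp.const_mul (-(2 * b)⁻¹)) using 1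
    simp
    field_simp
  have h := integral_mul_deriv_eq_deriv_mul_of_integrable
    (u := fun x : ℝ => x) (u' := fun _ => 1) (fun x _ => hasDerivAt_id x) (fun x _ => hderiv x)
    ((integrable_sq_mul_exp_neg_mul_sq hb).congr (.of_forall fun x => by simp; ring))
    (((integrable_exp_neg_mul_sq hb).const_mul (-(2 * b)⁻¹)).congr (.of_forall fun x => by simp))
    (((integrable_mul_exp_neg_mul_sq hb).const_mul (-(2 * b)⁻¹)).congr
      (.of_forall fun x => by simp; ring))
  calc ∫ x : ℝ, x ^ 2 * Real.exp (-b * x ^ 2)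
      = ∫ x : ℝ, x * (x * Real.exp (-b * x ^ 2)) := by simp only [← mul_assoc, sq]
    _ = _ := by rw [h, ← integral_neg, ← integral_const_mul]; simp

section DiagonalGaussian

variable {n : Type*} [Fintype n] {b : n → ℝ}

theorem exp_neg_sum_mul_sq (b x : n → ℝ) :
    Real.exp (-∑ i, b i * x i ^ 2) = ∏ i, Real.exp (-b i * x i ^ 2) := by
  rw [← Real.exp_sum, ← Finset.sum_neg_distrib]
  simp only [neg_mul]

theorem sq_mul_exp_neg_sum_mul_sq [DecidableEq n] (b x : n → ℝ) (j : n) :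
    x j ^ 2 * Real.exp (-∑ i, b i * x i ^ 2) =
      ∏ i, (if i = j then x i ^ 2 else 1) * Real.exp (-b i * x i ^ 2) := by
  rw [Finset.prod_mul_distrib, exp_neg_sum_mul_sq]
  simp

theorem integrable_exp_neg_sum_mul_sq (hb : ∀ i, 0 < b i) :
    Integrable fun x : n → ℝ => Real.exp (-∑ i, b i * x i ^ 2) := by
  simp only [exp_neg_sum_mul_sq]
  exact Integrable.fintype_prod (f := fun i (t : ℝ) => Real.exp (-b i * t ^ 2))
    fun i => integrable_exp_neg_mul_sq (hb i)

theorem integrable_sq_mul_exp_neg_sum_mul_sq (hb : ∀ i, 0 < b i) (j : n) :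
    Integrable fun x : n → ℝ => x j ^ 2 * Real.exp (-∑ i, b i * x i ^ 2) := by
  classical
  simp only [sq_mul_exp_neg_sum_mul_sq]
  refine Integrable.fintype_prod
    (f := fun i (t : ℝ) => (if i = j then t ^ 2 else 1) * Real.exp (-b i * t ^ 2)) fun i => ?_
  by_cases h : i = j
  · simpa [h] using integrable_sq_mul_exp_neg_mul_sq (hb j)
  · simpa [h] using integrable_exp_neg_mul_sq (hb i)

theorem integral_sq_mul_exp_neg_sum_mul_sq (hb : ∀ i, 0 < b i) (j : n) :
    ∫ x : n → ℝ, x j ^ 2 * Real.exp (-∑ i, b i * x i ^ 2) =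
      (2 * b j)⁻¹ * ∫ x : n → ℝ, Real.exp (-∑ i, b i * x i ^ 2) := by
  classical
  simp only [sq_mul_exp_neg_sum_mul_sq]
  simp only [exp_neg_sum_mul_sq]
  rw [integral_fintype_prod_volume_eq_prod
      (fun i (t : ℝ) => (if i = j then t ^ 2 else 1) * Real.exp (-b i * t ^ 2)),
    integral_fintype_prod_volume_eq_prod (fun i (t : ℝ) => Real.exp (-b i * t ^ 2))]
  have h (i : n) : ∫ t : ℝ, (if i = j then t ^ 2 else 1) * Real.exp (-b i * t ^ 2) =
      (if i = j then (2 * b i)⁻¹ else 1) * ∫ t : ℝ, Real.exp (-b i * t ^ 2) := by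
    by_cases hij : i = j
    · simpa [hij] using integral_sq_mul_exp_neg_mul_sq (hb j)
    · simp [hij]
  simp only [h, Finset.prod_mul_distrib]
  simp

end DiagonalGaussian

open Matrix in
theorem sum_mulVec_sq_of_transpose_mul_self {n : Type*} [Fintype n] [DecidableEq n]
    {U : Matrix n n ℝ} (hU : Uᵀ * U = 1) (x : n → ℝ) :
    ∑ i, (U *ᵥ x) i ^ 2 = ∑ i, x i ^ 2 := by
  have h : (U *ᵥ x) ⬝ᵥ (U *ᵥ x) = x ⬝ᵥ x := by
    rw [dotProduct_mulVec, vecMul_mulVec,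
      hU, vecMul_one]
  simpa [dotProduct, sq] using h

open Matrix in
theorem sum_mulVec_mul_diagonalization {n : Type*} [Fintype n] [DecidableEq n]
    {U : Matrix n n ℝ} (hU : Uᵀ * U = 1) (d x : n → ℝ) :
    ∑ i, (U *ᵥ x) i * ((U * diagonal d * Uᵀ) *ᵥ (U *ᵥ x)) i = ∑ i, d i * x i ^ 2 := by
  have h : (U *ᵥ x) ⬝ᵥ ((U * diagonal d * Uᵀ) *ᵥ (U *ᵥ x)) = x ⬝ᵥ (diagonal d *ᵥ x) := by
    rw [mulVec_mulVec, Matrix.mul_assoc, hU, Matrix.mul_one, ← mulVec_mulVec, dotProduct_mulVec,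
      vecMul_mulVec, hU, vecMul_one]
  calc _ = x ⬝ᵥ (diagonal d *ᵥ x) := h
    _ = _ := Finset.sum_congr rfl fun i _ => by rw [mulVec_diagonal]; ring

open Matrix in
theorem trace_inv_smul_one_sub_diagonalization {n : Type*} [Fintype n] [DecidableEq n]
    {U : Matrix n n ℝ} (hU : Uᵀ * U = 1) {d : n → ℝ} {z : ℝ} (hd : ∀ i, z - d i ≠ 0) :
    trace (z • (1 : Matrix n n ℝ) - U * diagonal d * Uᵀ)⁻¹ = ∑ i, (z - d i)⁻¹ := by
  have hU' : U * Uᵀ = 1 := mul_eq_one_comm.mp hU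
  have hinv : (z • (1 : Matrix n n ℝ) - U * diagonal d * Uᵀ)⁻¹ =
      U * diagonal (fun i => (z - d i)⁻¹) * Uᵀ := by
    have hz : z • (1 : Matrix n n ℝ) - U * diagonal d * Uᵀ =
        U * diagonal (fun i => z - d i) * Uᵀ := by
      have hdiag : diagonal (fun i => z - d i) = z • (1 : Matrix n n ℝ) - diagonal d := by
        rw [smul_one_eq_diagonal, diagonal_sub]
      rw [hdiag, Matrix.mul_sub, Matrix.sub_mul, Matrix.mul_smul, Matrix.mul_one, Matrix.smul_mul,
        hU']
    apply inv_eq_right_inv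
    rw [hz]
    calc U * diagonal (fun i => z - d i) * Uᵀ * (U * diagonal (fun i => (z - d i)⁻¹) * Uᵀ)
        = U * (diagonal (fun i => z - d i) * (Uᵀ * U) * diagonal (fun i => (z - d i)⁻¹)) * Uᵀ := by
          simp only [Matrix.mul_assoc]
      _ = 1 := by
        rw [hU, Matrix.mul_one, diagonal_mul_diagonal]
        simp [hd, hU']
  rw [hinv, trace_mul_comm, ← Matrix.mul_assoc, hU, Matrix.one_mul, trace_diagonal]

/-- **The Gaussian-integral resolvent trace of a matrix is the usual one (Proposition).**
For a real symmetric `N×N` matrix `M` and a real `z` larger than the operator norm of `M`,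
the Gaussian integrals `Ξ_M(z)` and `A_M(z)` converge, `Ξ_M(z) > 0`, and
`A_M(z)/Ξ_M(z) = (1/N) Tr((zI - M)⁻¹)`. -/
theorem gaussian_resolvent_eq_matrix_resolvent (N : ℕ)
    (M : Matrix (Fin N) (Fin N) ℝ) (hM : M.IsSymm)
    (z : ℝ) (hz : ‖Matrix.toEuclideanCLM (𝕜 := ℝ) M‖ < z) :
    Integrable
      (fun φ : Fin N → ℝ =>
        Real.exp (-(1 / 2) * ∑ x, φ x * (φ x - z⁻¹ * M.mulVec φ x)) *
          ((2 * Real.pi) ^ (-(N : ℝ) / 2))) volume ∧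
    Integrable
      (fun φ : Fin N → ℝ =>
        ((∑ x, φ x ^ 2) / N) *
          Real.exp (-(1 / 2) * ∑ x, φ x * (φ x - z⁻¹ * M.mulVec φ x)) *
          ((2 * Real.pi) ^ (-(N : ℝ) / 2))) volume ∧
    0 < XiM N M z ∧
    AM N M z / XiM N M z =
      (1 / (N : ℝ)) * Matrix.trace (z • (1 : Matrix (Fin N) (Fin N) ℝ) - M)⁻¹ := by
  obtain ⟨U, d, hU, rfl, hd⟩ := hM.exists_orthogonal_diagonalization
  have hz0 : 0 < z := (norm_nonneg _).trans_lt hz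
  have hdz (i : Fin N) : 0 < z - d i :=
    sub_pos.mpr ((le_abs_self _).trans_lt ((hd i).trans_lt hz))
  set b : Fin N → ℝ := fun i => (1 - z⁻¹ * d i) / 2 with hb_def
  have hb (i : Fin N) : 0 < b i := by
    have : b i = (z - d i) / (2 * z) := by simp only [hb_def]; field_simp
    rw [this]
    exact div_pos (hdz i) (by positivity)
  set c : ℝ := (2 * Real.pi) ^ (-(N : ℝ) / 2) with hc_def
  have hc : 0 < c := by positivity
  have hmp := measurePreserving_mulVec_of_transpose_mul_self hU
  have hemb := measurableEmbedding_mulVec_of_transpose_mul_self hU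
  have hsq := sum_mulVec_sq_of_transpose_mul_self hU
  have hexp (x : Fin N → ℝ) :
      -(1 / 2) * ∑ i, U.mulVec x i *
        (U.mulVec x i - z⁻¹ * (U * Matrix.diagonal d * U.transpose).mulVec (U.mulVec x) i) =
      -∑ i, b i * x i ^ 2 := by
    have h : ∑ i, U.mulVec x i *
        (U.mulVec x i - z⁻¹ * (U * Matrix.diagonal d * U.transpose).mulVec (U.mulVec x) i) =
        ∑ i, x i ^ 2 - z⁻¹ * ∑ i, d i * x i ^ 2 := by
      rw [← hsq, ← sum_mulVec_mul_diagonalization hU, Finset.mul_sum, ← Finset.sum_sub_distrib]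
      exact Finset.sum_congr rfl fun i _ => by ring
    rw [h, Finset.mul_sum, ← Finset.sum_sub_distrib, Finset.mul_sum, ← Finset.sum_neg_distrib]
    exact Finset.sum_congr rfl fun i _ => by simp only [hb_def]; ring
  have hweight (x : Fin N → ℝ) :
      (∑ i, x i ^ 2) / N * Real.exp (-∑ i, b i * x i ^ 2) * c =
        (c / N) * ∑ j, x j ^ 2 * Real.exp (-∑ i, b i * x i ^ 2) := by
    rw [← Finset.sum_mul]
    ring
  set G : ℝ := ∫ x : Fin N → ℝ, Real.exp (-∑ i, b i * x i ^ 2) with hG_def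
  have hG : 0 < G := integral_exp_pos (integrable_exp_neg_sum_mul_sq hb)
  have hXi : XiM N (U * Matrix.diagonal d * U.transpose) z = G * c := by
    rw [XiM, ← hmp.integral_comp hemb]
    simp only [hexp]
    rw [integral_mul_const]
  have hA : AM N (U * Matrix.diagonal d * U.transpose) z =
      z⁻¹ * ((c / N) * ∑ j, (2 * b j)⁻¹ * G) := by
    rw [AM, ← hmp.integral_comp hemb]
    simp only [hexp, hsq, ← hc_def, hweight]
    rw [integral_const_mul,
      integral_finsetSum _ fun j _ => integrable_sq_mul_exp_neg_sum_mul_sq hb j]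
    simp only [integral_sq_mul_exp_neg_sum_mul_sq hb, ← hG_def]
  refine ⟨?_, ?_, hXi ▸ mul_pos hG hc, ?_⟩
  · rw [← hmp.integrable_comp_emb hemb]
    simp only [Function.comp_def, hexp]
    exact (integrable_exp_neg_sum_mul_sq hb).mul_const c
  · rw [← hmp.integrable_comp_emb hemb]
    simp only [Function.comp_def, hexp, hsq, hweight]
    exact (integrable_finsetSum _ fun j _ =>
      integrable_sq_mul_exp_neg_sum_mul_sq hb j).const_mul _
  · rw [hA, hXi, trace_inv_smul_one_sub_diagonalization hU fun i => (hdz i).ne', ← Finset.sum_mul]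
    have hsum : ∑ i, (z - d i)⁻¹ = z⁻¹ * ∑ i, (2 * b i)⁻¹ := by
      rw [Finset.mul_sum]
      refine Finset.sum_congr rfl fun i _ => ?_
      rw [← mul_inv]
      congr 1
      simp only [hb_def]
      field_simp
    rw [hsum]
    field_simp
end
end
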